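/- Fix ℓ ∈ ℕ, t > 0, and let F : ℝ → ℂ be (ℓ+1)-times continuously differentiable such that F and all its derivatives up to order ℓ+1 are bounded. Let Y₀ be a real random variable with 𝔼Y₀ = 0 and finite absolute moments up to order ℓ+2, with cumulants κ^{(1)}, …, κ^{(ℓ+2)}, and let W be a centered Gaussian random variable independent of Y₀ with 𝔼W² = 𝔼Y₀². Set Y_t = e^{−t/2} Y₀ + √(1 − e^{−t}) W and Ẏ_t = −(1/2)e^{−t/2} Y₀ + (e^{−t}/(2√(1 − e^{−t}))) W. There is a numerical constant C > 0 such that for every ℓ there exists C_ℓ ≤ (Cℓ)^ℓ/ℓ! with: for every Q > 0, | 𝔼[Ẏ_t F(Y_t)] + (1/2) Σ_{r=2}^{ℓ} (κ^{(r+1)}/r!) e^{−(r+1)t/2} 𝔼[F^{(r)}(Y_t)] | ≤ C_ℓ 𝔼[|Y_t|^{ℓ+2}] · sup_{|x| ≤ Q} |F^{(ℓ+1)}(x)| + C_ℓ 𝔼[|Y_t|^{ℓ+2} 𝟙(|Y_t| > Q)] · sup_{x ∈ ℝ} |F^{(ℓ+1)}(x)|. -/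

import Mathlib

open MeasureTheory ProbabilityTheory

/-- `κ 1, …, κ n` are the cumulants of `Y` (moment–cumulant recursion
`𝔼[Y^m] = Σ_{k=1}^m C(m-1,k-1) κ^{(k)} 𝔼[Y^{m-k}]` for `1 ≤ m ≤ n`). -/
def IsCumulantSeq {Ω : Type*} [MeasurableSpace Ω] (μ : Measure Ω) (Y : Ω → ℝ)
    (n : ℕ) (κ : ℕ → ℝ) : Prop :=
  ∀ m : ℕ, 1 ≤ m → m ≤ n →
    ∫ ω, (Y ω)^m ∂μ
      = ∑ k ∈ Finset.Icc 1 m, ((m-1).choose (k-1) : ℝ) * κ k * ∫ ω, (Y ω)^(m-k) ∂μ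

open Finset in
theorem norm_sub_taylor_le {E : Type*} [NormedAddCommGroup E] [NormedSpace ℝ E] (n : ℕ) :
    ∀ {G : ℕ → ℝ → E}, (∀ j < n, ∀ x, HasDerivAt (G j) (G (j + 1) x) x) →
    ∀ {R S : ℝ}, (∀ y, |y| ≤ R → ‖G n y‖ ≤ S) → ∀ x, |x| ≤ R →
      ‖G 0 x - ∑ j ∈ range n, (x ^ j / (j.factorial : ℝ)) • G j 0‖ ≤ S * R ^ n := by
  induction n with
  | zero => intro G _ R S hS x hx; simpa using hS x hx
  | succ n ih =>
    intro G hG R S hS x hx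
    have hR : 0 ≤ R := (abs_nonneg x).trans hx
    have hS0 : 0 ≤ S := (norm_nonneg _).trans (hS x hx)
    have key := ih (G := fun j => G (j + 1)) (fun j hj => hG (j + 1) (by omega)) hS
    have hder : ∀ y, HasDerivAt
        (fun y => G 0 y - ∑ j ∈ range (n + 1), (y ^ j / (j.factorial : ℝ)) • G j 0)
        (G 1 y - ∑ j ∈ range n, (y ^ j / (j.factorial : ℝ)) • G (j + 1) 0) y := by
      intro y
      refine (hG 0 (by omega) y).sub ?_
      simp_rw [sum_range_succ' _ n]
      simp only [pow_zero]
      refine HasDerivAt.add_const _ (HasDerivAt.fun_sum fun j _ => ?_)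
      have h := ((hasDerivAt_pow (j + 1) y).div_const ((j + 1).factorial : ℝ)).smul_const
        (G (j + 1) 0)
      convert h using 2
      rw [Nat.factorial_succ]
      push_cast
      have : (j.factorial : ℝ) ≠ 0 := by positivity
      have : (j : ℝ) + 1 ≠ 0 := by positivity
      field_simp
    have hmem : ∀ y, y ∈ Set.Icc (-R) R ↔ |y| ≤ R := fun y => abs_le.symm
    have h := (convex_Icc (-R) R).norm_image_sub_le_of_norm_hasDerivWithin_le
      (fun y _ => (hder y).hasDerivWithinAt) (fun y hy => key y ((hmem y).1 hy))
      ((hmem 0).2 (by simpa using hR)) ((hmem x).2 hx)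
    have h0 : G 0 0 - ∑ j ∈ range (n + 1), ((0 : ℝ) ^ j / (j.factorial : ℝ)) • G j 0 = 0 := by
      simp [sum_range_succ']
    rw [h0, sub_zero, sub_zero, Real.norm_eq_abs] at h
    calc _ ≤ _ := h
      _ ≤ S * R ^ n * R := by gcongr
      _ = _ := by ring

theorem integral_mul_integral_le_integral_mul {Ω : Type*} [MeasurableSpace Ω] {μ : Measure Ω}
    [IsProbabilityMeasure μ] {f g : Ω → ℝ} (hfg : ∀ x y, 0 ≤ (f x - f y) * (g x - g y))
    (hf : Integrable f μ) (hg : Integrable g μ) (hi : Integrable (fun x => f x * g x) μ) :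
    (∫ x, f x ∂μ) * ∫ x, g x ∂μ ≤ ∫ x, f x * g x ∂μ := by
  have h1 : ∀ x, 0 ≤ f x * g x - f x * (∫ y, g y ∂μ) - (∫ y, f y ∂μ) * g x
      + ∫ y, f y * g y ∂μ := by
    intro x
    have h : 0 ≤ ∫ y, (f x - f y) * (g x - g y) ∂μ := integral_nonneg fun y => hfg x y
    have e : ∀ y, (f x - f y) * (g x - g y) = f x * g x - f x * g y - f y * g x + f y * g y :=
      fun y => by ring
    simp_rw [e] at h
    have i1 : Integrable (fun y => f x * g x - f x * g y) μ :=
      (integrable_const _).sub (hg.const_mul _)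
    have i2 : Integrable (fun y => f x * g x - f x * g y - f y * g x) μ :=
      i1.sub (hf.mul_const _)
    rw [integral_add i2 hi, integral_sub i1 (hf.mul_const _),
      integral_sub (integrable_const _) (hg.const_mul _), integral_const, integral_const_mul,
      integral_mul_const, probReal_univ, one_smul] at h
    exact h
  have h2 : 0 ≤ ∫ x, (f x * g x - f x * (∫ y, g y ∂μ) - (∫ y, f y ∂μ) * g x
      + ∫ y, f y * g y ∂μ) ∂μ := integral_nonneg h1
  have i1 : Integrable (fun x => f x * g x - f x * (∫ y, g y ∂μ)) μ := hi.sub (hf.mul_const _)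
  have i2 : Integrable (fun x => f x * g x - f x * (∫ y, g y ∂μ) - (∫ y, f y ∂μ) * g x) μ :=
    i1.sub (hg.const_mul _)
  rw [integral_add i2 (integrable_const _), integral_sub i1 (hg.const_mul _),
    integral_sub hi (hf.mul_const _), integral_const_mul, integral_mul_const, integral_const,
    probReal_univ, one_smul] at h2
  linarith

theorem isCumulantSeq_iff {Ω : Type*} [MeasurableSpace Ω] {μ : Measure Ω} {Y : Ω → ℝ}
    {n : ℕ} {κ : ℕ → ℝ} :
    IsCumulantSeq μ Y n κ ↔ ∀ m, m + 1 ≤ n → ∫ ω, (Y ω) ^ (m + 1) ∂μ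
      = ∑ r ∈ Finset.range (m + 1), (m.choose r : ℝ) * κ (r + 1) * ∫ ω, (Y ω) ^ (m - r) ∂μ := by
  have e : ∀ m, ∑ k ∈ Finset.Icc 1 (m + 1),
      (m.choose (k-1) : ℝ) * κ k * ∫ ω, (Y ω)^(m + 1 - k) ∂μ
      = ∑ r ∈ Finset.range (m + 1), (m.choose r : ℝ) * κ (r + 1) * ∫ ω, (Y ω) ^ (m - r) ∂μ := by
    intro m
    rw [← Finset.Ico_add_one_right_eq_Icc, Finset.sum_Ico_eq_sum_range]
    refine Finset.sum_congr (by simp) fun r _ => ?_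
    rw [show 1 + r - 1 = r by omega, show m + 1 - (1 + r) = m - r by omega, add_comm 1 r]
  constructor
  · intro h m hm
    rw [← e]
    exact h (m + 1) (by omega) hm
  · intro h m hm1 hm
    obtain ⟨m, rfl⟩ := Nat.exists_eq_add_of_le' hm1
    rw [h m hm, ← e]
    simp

theorem integral_abs_pow_mul_le {Ω : Type*} [MeasurableSpace Ω] {μ : Measure Ω}
    [IsProbabilityMeasure μ] {X : Ω → ℝ} {h : ℝ → ℝ} (hmono : MonotoneOn h (Set.Ici 0))
    (h0 : ∀ x, 0 ≤ h x) {p q : ℕ}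
    (hp : Integrable (fun ω => |X ω| ^ p) μ)
    (hq : Integrable (fun ω => |X ω| ^ q * h |X ω|) μ)
    (hpq : Integrable (fun ω => |X ω| ^ (p + q) * h |X ω|) μ) :
    (∫ ω, |X ω| ^ p ∂μ) * ∫ ω, |X ω| ^ q * h |X ω| ∂μ
      ≤ ∫ ω, |X ω| ^ (p + q) * h |X ω| ∂μ := by
  simp_rw [pow_add, mul_assoc] at hpq ⊢
  refine integral_mul_integral_le_integral_mul (fun x y => ?_) hp hq hpq
  have aux : ∀ a b : ℝ, 0 ≤ a → a ≤ b →
      0 ≤ (b ^ p - a ^ p) * (b ^ q * h b - a ^ q * h a) := by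
    intro a b ha hab
    have hh := hmono ha (ha.trans hab) hab
    refine mul_nonneg (sub_nonneg.2 (by gcongr)) (sub_nonneg.2 ?_)
    have := h0 a
    have := ha.trans hab
    gcongr
  rcases le_total (|X x|) (|X y|) with hxy | hxy
  · have := aux _ _ (abs_nonneg _) hxy
    linarith
  · exact aux _ _ (abs_nonneg _) hxy

theorem IsCumulantSeq.abs_le {Ω : Type*} [MeasurableSpace Ω] {μ : Measure Ω}
    [IsProbabilityMeasure μ] {X : Ω → ℝ} {n : ℕ} {κ : ℕ → ℝ} (hκ : IsCumulantSeq μ X n κ)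
    (hX : ∀ k ≤ n, Integrable (fun ω => |X ω| ^ k) μ) (m : ℕ) (hm : m + 1 ≤ n) :
    |κ (m + 1)| ≤ 2 ^ m * (m.factorial : ℝ) * ∫ ω, |X ω| ^ (m + 1) ∂μ := by
  induction m using Nat.strong_induction_on with
  | _ m ih =>
  set A := ∫ ω, |X ω| ^ (m + 1) ∂μ
  have hA : 0 ≤ A := integral_nonneg fun ω => by positivity
  have habs : ∀ k, |∫ ω, (X ω) ^ k ∂μ| ≤ ∫ ω, |X ω| ^ k ∂μ := fun k => by
    simpa only [abs_pow] using abs_integral_le_integral_abs (f := fun ω => X ω ^ k) (μ := μ)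
  have h := isCumulantSeq_iff.1 hκ m hm
  rw [Finset.sum_range_succ] at h
  simp only [Nat.choose_self, Nat.cast_one, one_mul, tsub_self, pow_zero, integral_const,
    probReal_univ, smul_eq_mul, mul_one] at h
  have hterm : ∀ r ∈ Finset.range m,
      |(m.choose r : ℝ) * κ (r + 1) * ∫ ω, (X ω) ^ (m - r) ∂μ| ≤ 2 ^ r * (m.factorial : ℝ) * A := by
    intro r hr
    have hr := Finset.mem_range.1 hr
    have hassoc := integral_abs_pow_mul_le (μ := μ) (X := X) (h := fun _ => 1) (p := r + 1)
      (q := m - r) (fun _ _ _ _ _ => le_rfl) (fun _ => zero_le_one) (hX _ (by omega))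
      (by simpa using hX _ (by omega)) (by simpa using hX _ (by omega))
    simp only [mul_one] at hassoc
    rw [show r + 1 + (m - r) = m + 1 by omega] at hassoc
    have hdesc : (m.choose r : ℝ) * (r.factorial : ℝ) ≤ (m.factorial : ℝ) := by
      rw [← Nat.choose_mul_factorial_mul_factorial hr.le]
      exact_mod_cast Nat.le_mul_of_pos_right _ (Nat.factorial_pos _)
    rw [abs_mul, abs_mul, Nat.abs_cast]
    calc (m.choose r : ℝ) * |κ (r + 1)| * |∫ ω, (X ω) ^ (m - r) ∂μ|
        ≤ (m.choose r : ℝ) * (2 ^ r * (r.factorial : ℝ) * ∫ ω, |X ω| ^ (r + 1) ∂μ)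
            * ∫ ω, |X ω| ^ (m - r) ∂μ := by
          have : 0 ≤ ∫ ω, |X ω| ^ (r + 1) ∂μ := integral_nonneg fun ω => by positivity
          gcongr
          · exact ih r hr (by omega)
          · exact habs _
      _ = 2 ^ r * ((m.choose r : ℝ) * (r.factorial : ℝ)) *
            ((∫ ω, |X ω| ^ (r + 1) ∂μ) * ∫ ω, |X ω| ^ (m - r) ∂μ) := by ring
      _ ≤ 2 ^ r * (m.factorial : ℝ) * A := by gcongr
  have hsum := (Finset.abs_sum_le_sum_abs _ _).trans (Finset.sum_le_sum hterm)
  have hgeom : ∑ r ∈ Finset.range m, (2 : ℝ) ^ r = 2 ^ m - 1 := by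
    rw [geom_sum_eq (by norm_num)]; norm_num
  simp_rw [mul_assoc] at hsum
  rw [← Finset.sum_mul, hgeom] at hsum
  simp_rw [← mul_assoc] at hsum
  have hfac : (1 : ℝ) ≤ m.factorial := by exact_mod_cast m.factorial_pos
  have hAm : A ≤ m.factorial * A := le_mul_of_one_le_left hA hfac
  rw [eq_sub_of_add_eq' h.symm]
  refine (abs_sub _ _).trans ?_
  linarith [habs (m + 1)]

/-- the identity `𝔼[X P(X)] = ∑ κ_{r+1}/r! 𝔼[P^{(r)}(X)]` -/
theorem moment_cumulant_taylor {E : Type*} [AddCommGroup E] [Module ℝ E] {M κ : ℕ → ℝ} {ℓ : ℕ}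
    (h : ∀ m ≤ ℓ, M (m + 1) = ∑ r ∈ Finset.range (m + 1),
      (m.choose r : ℝ) * κ (r + 1) * M (m - r)) (d : ℕ → E) :
    ∑ m ∈ Finset.range (ℓ + 1), (M (m + 1) / (m.factorial : ℝ)) • d m
      = ∑ r ∈ Finset.range (ℓ + 1), (κ (r + 1) / (r.factorial : ℝ)) •
          ∑ j ∈ Finset.range (ℓ + 1 - r), (M j / (j.factorial : ℝ)) • d (r + j) := by
  simp_rw [Finset.smul_sum]
  rw [← Finset.sum_range_diag_flip (ℓ + 1) fun r j =>
    (κ (r + 1) / (r.factorial : ℝ)) • (M j / (j.factorial : ℝ)) • d (r + j)]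
  refine Finset.sum_congr rfl fun m hm => ?_
  rw [h m (by simpa [Nat.lt_succ_iff] using hm), Finset.sum_div, Finset.sum_smul]
  refine Finset.sum_congr rfl fun r hr => ?_
  have hr : r ≤ m := by simpa [Nat.lt_succ_iff] using hr
  rw [Nat.add_sub_cancel' hr, smul_smul, Nat.cast_choose ℝ hr]
  congr 1
  field_simp

theorem hasDerivAt_gaussianPDFReal_zero (v : NNReal) (x : ℝ) :
    HasDerivAt (gaussianPDFReal 0 v) (-(x / v) * gaussianPDFReal 0 v x) x := by
  by_cases hv : v = 0
  · subst hv
    simp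
  have hv' : (v : ℝ) ≠ 0 := by exact_mod_cast hv
  rw [gaussianPDFReal_def]
  have h := (((((hasDerivAt_id x).sub_const 0).pow 2).neg.div_const (2 * (v : ℝ))).exp).const_mul
    ((√(2 * Real.pi * v))⁻¹)
  refine h.congr_deriv ?_
  simp
  field_simp

theorem integral_id_smul_gaussianReal {E : Type*} [NormedAddCommGroup E] [NormedSpace ℝ E]
    {v : NNReal} {G G' : ℝ → E} (hG : ∀ x, HasDerivAt G (G' x) x)
    (h1 : Integrable G (gaussianReal 0 v)) (h2 : Integrable (fun x => x • G x) (gaussianReal 0 v))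
    (h3 : Integrable G' (gaussianReal 0 v)) :
    ∫ x, x • G x ∂(gaussianReal 0 v) = (v : ℝ) • ∫ x, G' x ∂(gaussianReal 0 v) := by
  by_cases hv : v = 0
  · subst hv
    by_cases hE : CompleteSpace E
    · simp
    · simp [integral, hE]
  have hv' : (v : ℝ) ≠ 0 := by exact_mod_cast hv
  have hiff : ∀ g : ℝ → E, Integrable g (gaussianReal 0 v) →
      Integrable (fun x => gaussianPDFReal 0 v x • g x) := fun g hg => by
    rw [gaussianReal_of_var_ne_zero _ hv, integrable_withDensity_iff_integrable_smul'
      (measurable_gaussianPDF 0 v) (ae_of_all _ fun _ => gaussianPDF_lt_top)] at hg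
    simpa using hg
  have e : ∀ x, (-(x / v) * gaussianPDFReal 0 v x) • G x
      = (-(v : ℝ)⁻¹) • (gaussianPDFReal 0 v x • x • G x) := fun x => by
    rw [smul_smul, smul_smul]; congr 1; ring
  have h := integral_bilinear_hasDerivAt_right_eq_neg_left_of_integrable
    (L := ContinuousLinearMap.lsmul ℝ ℝ) (u := gaussianPDFReal 0 v) (v := G)
    (fun x _ => hasDerivAt_gaussianPDFReal_zero v x) (fun x _ => hG x)
    (by simpa using hiff _ h3)
    (by simp only [ContinuousLinearMap.lsmul_apply, e]; exact (hiff _ h2).smul _)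
    (by simpa using hiff _ h1)
  simp only [ContinuousLinearMap.lsmul_apply, e] at h
  rw [integral_gaussianReal_eq_integral_smul hv, integral_gaussianReal_eq_integral_smul hv, h,
    integral_smul, neg_smul, neg_neg, smul_smul, mul_inv_cancel₀ hv', one_smul]

section Independent

variable {Ω E : Type*} [MeasurableSpace Ω] [NormedAddCommGroup E] {μ : Measure Ω} {Y W : Ω → ℝ}

theorem identDistrib_prod_of_indepFun [IsProbabilityMeasure μ]
    (hY : Measurable Y) (hW : Measurable W)
    (h : IndepFun Y W μ) :
    IdentDistrib (fun ω => (Y ω, W ω)) (fun p : Ω × Ω => (Y p.1, W p.2)) μ (μ.prod μ) where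
  aemeasurable_fst := by fun_prop
  aemeasurable_snd := by fun_prop
  map_eq := by
    rw [h.map_prod_eq_prod_map_map hY.aemeasurable hW.aemeasurable, Measure.map_prod_map μ μ hY hW]
    rfl

theorem integrable_prod_of_indepFun [IsProbabilityMeasure μ]
    (hY : Measurable Y) (hW : Measurable W)
    (h : IndepFun Y W μ) {φ : ℝ × ℝ → E} (hφ : Continuous φ)
    (hi : Integrable (fun ω => φ (Y ω, W ω)) μ) :
    Integrable (fun p : Ω × Ω => φ (Y p.1, W p.2)) (μ.prod μ) := by
  have hm := identDistrib_prod_of_indepFun hY hW h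
  have h1 := (integrable_map_measure (f := fun ω => (Y ω, W ω)) (g := φ) hφ.aestronglyMeasurable
    hm.aemeasurable_fst).2 hi
  rw [hm.map_eq] at h1
  exact h1.comp_aemeasurable hm.aemeasurable_snd

theorem integral_eq_integral_prod_of_indepFun [IsProbabilityMeasure μ] [NormedSpace ℝ E]
    (hY : Measurable Y) (hW : Measurable W)
    (h : IndepFun Y W μ) {φ : ℝ × ℝ → E} (hφ : Continuous φ) :
    ∫ ω, φ (Y ω, W ω) ∂μ = ∫ p : Ω × Ω, φ (Y p.1, W p.2) ∂(μ.prod μ) := by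
  have hm := identDistrib_prod_of_indepFun hY hW h
  rw [← integral_map hm.aemeasurable_fst hφ.aestronglyMeasurable, hm.map_eq,
    integral_map hm.aemeasurable_snd hφ.aestronglyMeasurable]

theorem integral_gaussian_smul_comp_add [IsProbabilityMeasure μ] [NormedSpace ℝ E]
    (hY : Measurable Y) (hW : Measurable W)
    (h : IndepFun Y W μ) {v : NNReal} (hv : μ.map W = gaussianReal 0 v) {H H' : ℝ → E}
    (hH : ∀ x, HasDerivAt H (H' x) x) (hH' : Continuous H') (a b : ℝ)
    (h1 : Integrable (fun ω => H (a * Y ω + b * W ω)) μ)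
    (h2 : Integrable (fun ω => W ω • H (a * Y ω + b * W ω)) μ)
    (h3 : Integrable (fun ω => H' (a * Y ω + b * W ω)) μ) :
    ∫ ω, W ω • H (a * Y ω + b * W ω) ∂μ = (b * v) • ∫ ω, H' (a * Y ω + b * W ω) ∂μ := by
  have hHc : Continuous H := continuous_iff_continuousAt.2 fun x => (hH x).continuousAt
  have c1 : Continuous fun p : ℝ × ℝ => H (a * p.1 + b * p.2) := by fun_prop
  have c2 : Continuous fun p : ℝ × ℝ => p.2 • H (a * p.1 + b * p.2) := by fun_prop
  have c3 : Continuous fun p : ℝ × ℝ => H' (a * p.1 + b * p.2) := by fun_prop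
  have i1 := integrable_prod_of_indepFun hY hW h c1 h1
  have i2 := integrable_prod_of_indepFun hY hW h c2 h2
  have i3 := integrable_prod_of_indepFun hY hW h c3 h3
  rw [integral_eq_integral_prod_of_indepFun hY hW h c2,
    integral_eq_integral_prod_of_indepFun hY hW h c3, integral_prod _ i2, integral_prod _ i3,
    ← integral_smul]
  refine integral_congr_ae ?_
  filter_upwards [i1.prod_right_ae, i2.prod_right_ae, i3.prod_right_ae] with ω j1 j2 j3
  have d : ∀ x, HasDerivAt (fun x => H (a * Y ω + b * x)) (b • H' (a * Y ω + b * x)) x := by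
    intro x
    have hl : HasDerivAt (fun x => a * Y ω + b * x) b x := by
      simpa using ((hasDerivAt_id x).const_mul b).const_add (a * Y ω)
    exact (hH _).scomp x hl
  have tr : ∀ {g : ℝ → E}, Continuous g → Integrable (fun ω => g (W ω)) μ →
      Integrable g (gaussianReal 0 v) := fun {g} hg hi => by
    rw [← hv]
    exact (integrable_map_measure hg.aestronglyMeasurable hW.aemeasurable).2 hi
  have k1 : Continuous fun x => H (a * Y ω + b * x) := by fun_prop
  have k2 : Continuous fun x => x • H (a * Y ω + b * x) := by fun_prop
  have k3 : Continuous fun x => b • H' (a * Y ω + b * x) := by fun_prop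
  have st := integral_id_smul_gaussianReal d (tr k1 j1) (tr k2 j2) (tr k3 (j3.smul b))
  rw [← hv, integral_map hW.aemeasurable k2.aestronglyMeasurable,
    integral_map hW.aemeasurable k3.aestronglyMeasurable, integral_smul, smul_smul] at st
  rw [mul_comm b]
  exact st

theorem IsCumulantSeq.integral_mul_add_const_pow [IsProbabilityMeasure μ]
    {X : Ω → ℝ} {n : ℕ} {κ : ℕ → ℝ}
    (hX : Measurable X) (hXi : ∀ k ≤ n, Integrable (fun ω => |X ω| ^ k) μ)
    (hκ : IsCumulantSeq μ X n κ) (c : ℝ) {m : ℕ} (hm : m + 1 ≤ n) :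
    ∫ ω, X ω * (X ω + c) ^ m ∂μ = ∑ r ∈ Finset.range (m + 1),
      (m.choose r : ℝ) * κ (r + 1) * ∫ ω, (X ω + c) ^ (m - r) ∂μ := by
  have hXi' : ∀ k ≤ n, Integrable (fun ω => X ω ^ k) μ := fun k hk =>
    (hXi k hk).mono' (hX.pow_const k).aestronglyMeasurable (ae_of_all _ fun ω => by simp)
  have key := moment_cumulant_taylor (M := fun k => ∫ ω, X ω ^ k ∂μ) (ℓ := m)
    (fun k hk => isCumulantSeq_iff.1 hκ k (by omega))
    (fun j => (m.factorial : ℝ) / ((m - j).factorial : ℝ) * c ^ (m - j))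
  have hf : ∀ k : ℕ, (k.factorial : ℝ) ≠ 0 := fun k => by positivity
  convert key using 1
  · simp_rw [add_pow, Finset.mul_sum]
    rw [integral_finsetSum]
    · refine Finset.sum_congr rfl fun j hj => ?_
      have hj : j ≤ m := by simpa [Nat.lt_succ_iff] using hj
      have e : ∀ ω, X ω * (X ω ^ j * c ^ (m - j) * (m.choose j : ℝ))
          = X ω ^ (j + 1) * (c ^ (m - j) * (m.choose j : ℝ)) := fun ω => by ring
      simp_rw [e]
      rw [integral_mul_const, Nat.cast_choose ℝ hj, smul_eq_mul]
      field_simp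
    · intro j hj
      have hj : j ≤ m := by simpa [Nat.lt_succ_iff] using hj
      have e : ∀ ω, X ω * (X ω ^ j * c ^ (m - j) * (m.choose j : ℝ))
          = X ω ^ (j + 1) * (c ^ (m - j) * (m.choose j : ℝ)) := fun ω => by ring
      simp_rw [e]
      exact (hXi' _ (by omega)).mul_const _
  · refine Finset.sum_congr rfl fun r hr => ?_
    have hr : r ≤ m := by simpa [Nat.lt_succ_iff] using hr
    simp_rw [add_pow]
    rw [integral_finsetSum _ fun j hj => ?_, show m + 1 - r = m - r + 1 by omega, Finset.mul_sum,
      Finset.smul_sum]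
    · refine Finset.sum_congr rfl fun j hj => ?_
      have hj : j ≤ m - r := by simpa [Nat.lt_succ_iff] using hj
      simp_rw [mul_assoc]
      rw [integral_mul_const, Nat.cast_choose ℝ hj, Nat.cast_choose ℝ hr, smul_eq_mul, smul_eq_mul,
        show m - (r + j) = m - r - j by omega]
      have := hf (m - r)
      have := hf (m - r - j)
      field_simp
    · have hj : j ≤ m - r := by simpa [Nat.lt_succ_iff] using hj
      simp_rw [mul_assoc]
      exact (hXi' _ (by omega)).mul_const _

theorem IsCumulantSeq.const_mul {X : Ω → ℝ} {n : ℕ} {κ : ℕ → ℝ} (hκ : IsCumulantSeq μ X n κ)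
    (a : ℝ) : IsCumulantSeq μ (fun ω => a * X ω) n (fun k => a ^ k * κ k) := by
  rw [isCumulantSeq_iff] at hκ ⊢
  intro m hm
  simp_rw [mul_pow, integral_const_mul]
  rw [hκ m hm, Finset.mul_sum]
  refine Finset.sum_congr rfl fun r hr => ?_
  have hr : r ≤ m := by simpa [Nat.lt_succ_iff] using hr
  rw [show m + 1 = (r + 1) + (m - r) by omega, pow_add]
  ring

theorem integrable_abs_linear_comb_pow {k : ℕ} (hY : Measurable Y) (hW : Measurable W)
    (hYi : Integrable (fun ω => |Y ω| ^ k) μ) (hWi : Integrable (fun ω => |W ω| ^ k) μ)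
    (a b : ℝ) : Integrable (fun ω => |a * Y ω + b * W ω| ^ k) μ := by
  refine (((hYi.const_mul (|a| ^ k)).add (hWi.const_mul (|b| ^ k))).const_mul
    (2 ^ (k - 1))).mono' (by fun_prop) (ae_of_all _ fun ω => ?_)
  rw [Real.norm_of_nonneg (by positivity)]
  calc |a * Y ω + b * W ω| ^ k ≤ (|a| * |Y ω| + |b| * |W ω|) ^ k := by
        gcongr
        simpa [abs_mul] using abs_add_le (a * Y ω) (b * W ω)
    _ ≤ _ := by
        simpa [mul_pow] using add_pow_le (by positivity : 0 ≤ |a| * |Y ω|)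
          (by positivity : 0 ≤ |b| * |W ω|) k

theorem integrable_mul_pow {k : ℕ} (hY : Measurable Y) (hW : Measurable W)
    (hYi : Integrable (fun ω => |Y ω| ^ (k + 1)) μ)
    (hWi : Integrable (fun ω => |W ω| ^ (k + 1)) μ) :
    Integrable (fun ω => Y ω * W ω ^ k) μ := by
  refine (hYi.add hWi).mono' (by fun_prop) (ae_of_all _ fun ω => ?_)
  have h1 := abs_nonneg (Y ω)
  have h2 := abs_nonneg (W ω)
  simp only [Real.norm_eq_abs, abs_mul, abs_pow, Pi.add_apply]
  rcases le_total (|Y ω|) (|W ω|) with hle | hle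
  · calc |Y ω| * |W ω| ^ k ≤ |W ω| * |W ω| ^ k := by gcongr
      _ = |W ω| ^ (k + 1) := by ring
      _ ≤ _ := le_add_of_nonneg_left (by positivity)
  · calc |Y ω| * |W ω| ^ k ≤ |Y ω| * |Y ω| ^ k := by gcongr
      _ = |Y ω| ^ (k + 1) := by ring
      _ ≤ _ := le_add_of_nonneg_right (by positivity)

theorem integrable_abs_pow_of_gaussian [IsProbabilityMeasure μ] (hW : Measurable W) {v : NNReal}
    (hv : μ.map W = gaussianReal 0 v) (k : ℕ) : Integrable (fun ω => |W ω| ^ k) μ := by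
  have h := (memLp_id_gaussianReal (μ := 0) (v := v) k).integrable_norm_pow'
  rw [← hv] at h
  simpa [Function.comp_def] using h.comp_measurable hW

theorem IsCumulantSeq.add_gaussian [IsProbabilityMeasure μ] {n : ℕ} {κ : ℕ → ℝ} (hY : Measurable Y)
    (hYi : ∀ k ≤ n, Integrable (fun ω => |Y ω| ^ k) μ) (hκ : IsCumulantSeq μ Y n κ)
    (hW : Measurable W) (h : IndepFun Y W μ) {v : NNReal} (hv : μ.map W = gaussianReal 0 v)
    (a b : ℝ) :
    IsCumulantSeq μ (fun ω => a * Y ω + b * W ω) n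
      (fun k => a ^ k * κ k + if k = 2 then b ^ 2 * v else 0) := by
  have hWi := integrable_abs_pow_of_gaussian hW hv
  have hZi : ∀ k ≤ n, Integrable (fun ω => |a * Y ω + b * W ω| ^ k) μ := fun k hk =>
    integrable_abs_linear_comb_pow hY hW (hYi k hk) (hWi k) a b
  have hZm : Measurable (fun ω => a * Y ω + b * W ω) := by fun_prop
  have hZi' : ∀ k ≤ n, Integrable (fun ω => (a * Y ω + b * W ω) ^ k) μ := fun k hk =>
    (hZi k hk).mono' (hZm.pow_const k).aestronglyMeasurable (ae_of_all _ fun ω => by simp)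
  rw [isCumulantSeq_iff]
  intro m hm
  have iY : Integrable (fun ω => a * Y ω * (a * Y ω + b * W ω) ^ m) μ := by
    simp_rw [mul_assoc]
    exact (integrable_mul_pow hY hZm (hYi _ hm) (hZi _ hm)).const_mul a
  have iW := integrable_mul_pow hW hZm (hWi _) (hZi _ hm)
  have hstein : ∫ ω, W ω * (a * Y ω + b * W ω) ^ m ∂μ
      = b * v * (m * ∫ ω, (a * Y ω + b * W ω) ^ (m - 1) ∂μ) := by
    have := integral_gaussian_smul_comp_add hY hW h hv (H := fun x : ℝ => x ^ m)
      (H' := fun x => m * x ^ (m - 1)) (fun x => hasDerivAt_pow m x) (by fun_prop) a b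
      (hZi' _ (by omega)) iW ((hZi' _ (by omega)).const_mul _)
    simpa only [smul_eq_mul, integral_const_mul] using this
  have hfirst : ∫ ω, a * Y ω * (a * Y ω + b * W ω) ^ m ∂μ = ∑ r ∈ Finset.range (m + 1),
      (m.choose r : ℝ) * (a ^ (r + 1) * κ (r + 1)) * ∫ ω, (a * Y ω + b * W ω) ^ (m - r) ∂μ := by
    have c1 : Continuous fun p : ℝ × ℝ => a * p.1 * (a * p.1 + b * p.2) ^ m := by fun_prop
    have c2 : ∀ r, Continuous fun p : ℝ × ℝ => (a * p.1 + b * p.2) ^ (m - r) := fun r => by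
      fun_prop
    have i2 := fun r => integrable_prod_of_indepFun hY hW h (c2 r) (hZi' _ (by omega))
    rw [integral_eq_integral_prod_of_indepFun hY hW h c1,
      integral_prod_symm _ (integrable_prod_of_indepFun hY hW h c1 iY)]
    have hshift := fun c => (hκ.const_mul a).integral_mul_add_const_pow (hY.const_mul a)
      (fun k hk => by
        simpa only [abs_mul, mul_pow] using (hYi k hk).const_mul (|a| ^ k)) c hm
    simp_rw [hshift]
    rw [integral_finsetSum _ fun r _ => (i2 r).integral_prod_right.const_mul _]
    refine Finset.sum_congr rfl fun r _ => ?_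
    rw [integral_const_mul, integral_eq_integral_prod_of_indepFun hY hW h (c2 r),
      integral_prod_symm _ (i2 r)]
  have hsplit : ∫ ω, (a * Y ω + b * W ω) ^ (m + 1) ∂μ
      = ∫ ω, a * Y ω * (a * Y ω + b * W ω) ^ m ∂μ
        + b * ∫ ω, W ω * (a * Y ω + b * W ω) ^ m ∂μ := by
    rw [← integral_const_mul, ← integral_add iY (iW.const_mul b)]
    exact integral_congr_ae (ae_of_all _ fun ω => by ring)
  rw [hsplit, hstein, hfirst]
  simp_rw [mul_add, add_mul]
  rw [Finset.sum_add_distrib]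
  congr 1
  cases m with
  | zero => simp
  | succ m =>
    rw [Finset.sum_eq_single 1]
    · simp; ring
    · intro r _ hr
      simp [hr]
    · simp

end Independent

theorem norm_integral_smul_sub_cumulant_sum_le {Ω E : Type*} [MeasurableSpace Ω]
    [NormedAddCommGroup E] [NormedSpace ℝ E] [CompleteSpace E] {μ : Measure Ω}
    [IsProbabilityMeasure μ] {X : Ω → ℝ} (hX : Measurable X) {ℓ : ℕ}
    (hXi : ∀ k ≤ ℓ + 2, Integrable (fun ω => |X ω| ^ k) μ) {κ : ℕ → ℝ}
    (hκ : IsCumulantSeq μ X (ℓ + 2) κ) (hκ1 : κ 1 = 0) {G : ℕ → ℝ → E}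
    (hG : ∀ j ≤ ℓ, ∀ x, HasDerivAt (G j) (G (j + 1) x) x)
    (hGb : ∀ j ≤ ℓ, ∃ B : ℝ, ∀ x, ‖G j x‖ ≤ B) {h : ℝ → ℝ} (hh : Measurable h)
    (hmono : MonotoneOn h (Set.Ici 0)) (h0 : ∀ x, 0 ≤ h x) (hb : ∃ B : ℝ, ∀ x, h x ≤ B)
    (hGh : ∀ x, ‖G (ℓ + 1) x‖ ≤ h |x|) :
    ‖∫ ω, X ω • G 0 (X ω) ∂μ - ∑ r ∈ Finset.range (ℓ + 1),
        (κ (r + 1) / (r.factorial : ℝ)) • ∫ ω, G r (X ω) ∂μ‖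
      ≤ (2 ^ (ℓ + 1) - 1) * ∫ ω, |X ω| ^ (ℓ + 2) * h |X ω| ∂μ := by
  obtain ⟨B, hB⟩ := hb
  have hXi' : ∀ k ≤ ℓ + 2, Integrable (fun ω => X ω ^ k) μ := fun k hk =>
    (hXi k hk).mono' (hX.pow_const k).aestronglyMeasurable (ae_of_all _ fun ω => by simp)
  have hhi : ∀ k ≤ ℓ + 2, Integrable (fun ω => |X ω| ^ k * h |X ω|) μ := fun k hk =>
    ((hXi k hk).mul_const B).mono' (by fun_prop) (ae_of_all _ fun ω => by
      rw [Real.norm_of_nonneg (mul_nonneg (by positivity) (h0 _))]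
      gcongr
      exact hB _)
  have hGc : ∀ j ≤ ℓ, Continuous (G j) := fun j hj =>
    continuous_iff_continuousAt.2 fun x => (hG j hj x).continuousAt
  have hGm : ∀ j ≤ ℓ, AEStronglyMeasurable (fun ω => G j (X ω)) μ := fun j hj =>
    ((hGc j hj).stronglyMeasurable.comp_measurable hX).aestronglyMeasurable
  have hGi : ∀ j ≤ ℓ, Integrable (fun ω => G j (X ω)) μ := fun j hj => by
    obtain ⟨C, hC⟩ := hGb j hj
    exact (integrable_const C).mono' (hGm j hj) (ae_of_all _ fun ω => hC _)
  have hXG : Integrable (fun ω => X ω • G 0 (X ω)) μ := by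
    obtain ⟨C, hC⟩ := hGb 0 (by omega)
    refine ((hXi 1 (by omega)).mul_const C).mono'
      (hX.aestronglyMeasurable.smul (hGm 0 (by omega))) (ae_of_all _ fun ω => ?_)
    rw [norm_smul, pow_one, Real.norm_eq_abs]
    gcongr
    exact hC _
  set T : ℕ → ℝ → E := fun r x =>
    ∑ j ∈ Finset.range (ℓ + 1 - r), (x ^ j / (j.factorial : ℝ)) • G (r + j) 0 with hT
  have hTi : ∀ r, Integrable (fun ω => T r (X ω)) μ := fun r =>
    integrable_finsetSum _ fun j hj => by
      have := Finset.mem_range.1 hj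
      exact ((hXi' j (by omega)).div_const _).smul_const _
  have hXTe : ∀ x : ℝ, x • T 0 x
      = ∑ j ∈ Finset.range (ℓ + 1), (x ^ (j + 1) / (j.factorial : ℝ)) • G j 0 := fun x => by
    simp only [hT, Finset.smul_sum, smul_smul, Nat.sub_zero, zero_add]
    exact Finset.sum_congr rfl fun j _ => by congr 1; ring
  have hXTi : ∀ j ∈ Finset.range (ℓ + 1),
      Integrable (fun ω => (X ω ^ (j + 1) / (j.factorial : ℝ)) • G j 0) μ := fun j hj => by
    have := Finset.mem_range.1 hj
    exact ((hXi' (j + 1) (by omega)).div_const _).smul_const _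
  have hXT : Integrable (fun ω => X ω • T 0 (X ω)) μ := by
    simp_rw [hXTe]
    exact integrable_finsetSum _ hXTi
  have hpoly : ∫ ω, X ω • T 0 (X ω) ∂μ = ∑ r ∈ Finset.range (ℓ + 1),
      (κ (r + 1) / (r.factorial : ℝ)) • ∫ ω, T r (X ω) ∂μ := by
    have key := moment_cumulant_taylor (M := fun k => ∫ ω, X ω ^ k ∂μ) (ℓ := ℓ)
      (fun k hk => isCumulantSeq_iff.1 hκ k (by omega)) (fun j => G j 0)
    convert key using 1
    · simp_rw [hXTe]
      rw [integral_finsetSum _ hXTi]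
      exact Finset.sum_congr rfl fun j _ => by rw [integral_smul_const, integral_div]
    · refine Finset.sum_congr rfl fun r _ => ?_
      simp only [hT]
      rw [integral_finsetSum]
      · congr 1
        exact Finset.sum_congr rfl fun j _ => by rw [integral_smul_const, integral_div]
      · intro j hj
        have := Finset.mem_range.1 hj
        exact ((hXi' j (by omega)).div_const _).smul_const _
  have hrem : ∀ r ≤ ℓ, ∀ x, ‖G r x - T r x‖ ≤ |x| ^ (ℓ + 1 - r) * h |x| := by
    intro r hr x
    rw [mul_comm]
    refine norm_sub_taylor_le (ℓ + 1 - r) (G := fun j => G (r + j))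
      (fun j hj y => hG (r + j) (by omega) y) (fun y hy => ?_) x le_rfl
    rw [Nat.add_sub_cancel' (by omega)]
    exact (hGh y).trans (hmono (abs_nonneg y) (abs_nonneg x) hy)
  set A := ∫ ω, |X ω| ^ (ℓ + 2) * h |X ω| ∂μ
  have hdiff : ∫ ω, X ω • G 0 (X ω) ∂μ - ∑ r ∈ Finset.range (ℓ + 1),
        (κ (r + 1) / (r.factorial : ℝ)) • ∫ ω, G r (X ω) ∂μ
      = ∫ ω, X ω • (G 0 (X ω) - T 0 (X ω)) ∂μ - ∑ r ∈ Finset.range (ℓ + 1),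
        (κ (r + 1) / (r.factorial : ℝ)) • ∫ ω, (G r (X ω) - T r (X ω)) ∂μ := by
    have e : ∀ r ∈ Finset.range (ℓ + 1),
        (κ (r + 1) / (r.factorial : ℝ)) • ∫ ω, (G r (X ω) - T r (X ω)) ∂μ
        = (κ (r + 1) / (r.factorial : ℝ)) • ∫ ω, G r (X ω) ∂μ
          - (κ (r + 1) / (r.factorial : ℝ)) • ∫ ω, T r (X ω) ∂μ := fun r hr => by
      rw [integral_sub (hGi r (by simpa [Nat.lt_succ_iff] using hr)) (hTi r), smul_sub]
    rw [Finset.sum_congr rfl e, Finset.sum_sub_distrib, ← hpoly]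
    simp_rw [smul_sub]
    rw [integral_sub hXG hXT]
    abel
  have hfirst : ‖∫ ω, X ω • (G 0 (X ω) - T 0 (X ω)) ∂μ‖ ≤ A := by
    refine norm_integral_le_of_norm_le (hhi _ le_rfl) (ae_of_all _ fun ω => ?_)
    rw [norm_smul, Real.norm_eq_abs, pow_succ' _ (ℓ + 1), mul_assoc]
    gcongr
    exact hrem 0 (by omega) _
  have hterm : ∀ r ≤ ℓ, ‖(κ (r + 1) / (r.factorial : ℝ)) •
      ∫ ω, (G r (X ω) - T r (X ω)) ∂μ‖ ≤ 2 ^ r * A := by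
    intro r hr
    have hk := hκ.abs_le hXi r (by omega)
    have hi := norm_integral_le_of_norm_le (hhi (ℓ + 1 - r) (by omega))
      (ae_of_all _ fun ω => hrem r hr (X ω))
    have hpq : r + 1 + (ℓ + 1 - r) = ℓ + 2 := by omega
    have hassoc := integral_abs_pow_mul_le hmono h0 (hXi (r + 1) (by omega))
      (hhi (ℓ + 1 - r) (by omega)) (by rw [hpq]; exact hhi _ le_rfl)
    rw [hpq] at hassoc
    have hf : (0 : ℝ) < r.factorial := by positivity
    have hk' : |κ (r + 1) / (r.factorial : ℝ)| ≤ 2 ^ r * ∫ ω, |X ω| ^ (r + 1) ∂μ := by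
      rw [abs_div, Nat.abs_cast, div_le_iff₀ hf]
      linarith
    rw [norm_smul, Real.norm_eq_abs]
    calc _ ≤ (2 ^ r * ∫ ω, |X ω| ^ (r + 1) ∂μ) * ∫ ω, |X ω| ^ (ℓ + 1 - r) * h |X ω| ∂μ :=
          mul_le_mul hk' hi (norm_nonneg _) ((abs_nonneg _).trans hk')
      _ = 2 ^ r * ((∫ ω, |X ω| ^ (r + 1) ∂μ) * ∫ ω, |X ω| ^ (ℓ + 1 - r) * h |X ω| ∂μ) := by ring
      _ ≤ 2 ^ r * A := by gcongr
  rw [hdiff, Finset.sum_range_succ' _ ℓ]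
  simp only [zero_add, hκ1, zero_div, zero_smul, add_zero]
  refine (norm_sub_le _ _).trans ?_
  have hsum : ‖∑ r ∈ Finset.range ℓ, (κ (r + 1 + 1) / ((r + 1).factorial : ℝ)) •
      ∫ ω, (G (r + 1) (X ω) - T (r + 1) (X ω)) ∂μ‖ ≤ ∑ r ∈ Finset.range ℓ, 2 ^ (r + 1) * A :=
    norm_sum_le_of_le _ fun r hr => hterm (r + 1) (Finset.mem_range.1 hr)
  have hgeom : ∑ r ∈ Finset.range ℓ, (2 : ℝ) ^ (r + 1) = 2 ^ (ℓ + 1) - 2 := by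
    simp_rw [pow_succ]
    rw [← Finset.sum_mul, geom_sum_eq (by norm_num)]
    ring
  rw [← Finset.sum_mul, hgeom] at hsum
  linarith

theorem two_pow_le_two_mul_pow_div_factorial (ℓ : ℕ) :
    (2 : ℝ) ^ ℓ ≤ (2 * (ℓ : ℝ)) ^ ℓ / (Nat.factorial ℓ : ℝ) := by
  rw [le_div_iff₀ (by positivity), mul_pow]
  gcongr
  exact_mod_cast Nat.factorial_le_pow ℓ

theorem integral_mul_add_ite {Ω : Type*} [MeasurableSpace Ω] {μ : Measure Ω} {f g : Ω → ℝ}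
    (hf : Integrable f μ) (hg : Measurable g) (q s S : ℝ) :
    ∫ ω, f ω * (s + if q < g ω then S else 0) ∂μ
      = (∫ ω, f ω ∂μ) * s + (∫ ω in {ω | q < g ω}, f ω ∂μ) * S := by
  have hm : MeasurableSet {ω | q < g ω} := measurableSet_lt measurable_const hg
  have e : ∀ ω, f ω * (s + if q < g ω then S else 0)
      = f ω * s + {ω | q < g ω}.indicator (fun ω => f ω * S) ω := fun ω => by
    by_cases hq : q < g ω <;> simp [hq, mul_add]
  simp_rw [e]
  rw [integral_add (hf.mul_const _) ((hf.mul_const _).indicator hm), integral_indicator hm,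
    integral_mul_const, integral_mul_const]

/-- cumulant expansion along the Ornstein–Uhlenbeck-type flow
`Y_t = e^{-t/2} Y₀ + √(1-e^{-t}) W` with `W` Gaussian, independent of `Y₀`, with
`𝔼W² = 𝔼Y₀²`: `𝔼[Ẏ_t F(Y_t)]` equals `-(1/2) Σ_{r=2}^ℓ (κ^{(r+1)}/r!) e^{-(r+1)t/2}
𝔼[F^{(r)}(Y_t)]` up to the stated error. -/
theorem stmt19 :
    ∃ C > (0:ℝ), ∀ ℓ : ℕ, ∃ Cl : ℝ, Cl ≤ (C * (ℓ:ℝ))^ℓ / (Nat.factorial ℓ : ℝ) ∧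
      ∀ (Ω : Type) [MeasurableSpace Ω] (μ : Measure Ω), IsProbabilityMeasure μ →
      ∀ Y : Ω → ℝ, Measurable Y →
        (∀ k : ℕ, k ≤ ℓ + 2 → Integrable (fun ω => |Y ω|^k) μ) →
        (∫ ω, Y ω ∂μ) = 0 →
      ∀ κ : ℕ → ℝ, IsCumulantSeq μ Y (ℓ + 2) κ →
      ∀ W : Ω → ℝ, Measurable W → IndepFun Y W μ →
      ∀ v : NNReal, Measure.map W μ = gaussianReal 0 v → (v : ℝ) = ∫ ω, (Y ω)^2 ∂μ →
      ∀ t : ℝ, 0 < t →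
      ∀ F : ℝ → ℂ, ContDiff ℝ (ℓ + 1 : ℕ) F →
        (∀ r : ℕ, r ≤ ℓ + 1 → ∃ B : ℝ, ∀ x : ℝ, ‖iteratedDeriv r F x‖ ≤ B) →
      ∀ Q : ℝ, 0 < Q →
      ‖(∫ ω, ((-(1/2) * Real.exp (-t/2) * Y ω
              + Real.exp (-t) / (2 * Real.sqrt (1 - Real.exp (-t))) * W ω : ℝ) : ℂ)
            * F (Real.exp (-t/2) * Y ω + Real.sqrt (1 - Real.exp (-t)) * W ω) ∂μ)
          + (1/2 : ℂ) * ∑ r ∈ Finset.Icc 2 ℓ,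
              ((κ (r+1) / (Nat.factorial r : ℝ) * Real.exp (-((r:ℝ)+1)*t/2) : ℝ) : ℂ)
                * ∫ ω, iteratedDeriv r F
                    (Real.exp (-t/2) * Y ω + Real.sqrt (1 - Real.exp (-t)) * W ω) ∂μ‖
        ≤ Cl * (∫ ω, |Real.exp (-t/2) * Y ω + Real.sqrt (1 - Real.exp (-t)) * W ω|^(ℓ+2) ∂μ)
            * (⨆ x ∈ Set.Icc (-Q) Q, ‖iteratedDeriv (ℓ+1) F x‖)
          + Cl * (∫ ω in {ω | Q < |Real.exp (-t/2) * Y ω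
                + Real.sqrt (1 - Real.exp (-t)) * W ω|},
              |Real.exp (-t/2) * Y ω + Real.sqrt (1 - Real.exp (-t)) * W ω|^(ℓ+2) ∂μ)
            * (⨆ x : ℝ, ‖iteratedDeriv (ℓ+1) F x‖) := by
  refine ⟨2, by norm_num, fun ℓ => ⟨2 ^ ℓ, two_pow_le_two_mul_pow_div_factorial ℓ, ?_⟩⟩
  intro Ω _ μ _ Y hY hYi hY0 κ hκ W hW hind v hv hvar t ht F hF hFb Q hQ
  set a := Real.exp (-t / 2) with ha
  have ha2 : Real.exp (-t) = a ^ 2 := by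
    rw [ha, ← Real.exp_nat_mul]; congr 1; push_cast; ring
  have hlt : a ^ 2 < 1 := by rw [← ha2]; exact Real.exp_lt_one_iff.2 (by linarith)
  rw [ha2]
  set b := √(1 - a ^ 2) with hb
  have hb0 : 0 < b := Real.sqrt_pos.2 (by linarith)
  have hb2 : b ^ 2 = 1 - a ^ 2 := Real.sq_sqrt (by linarith)
  set G : ℕ → ℝ → ℂ := fun r => iteratedDeriv r F with hGdef
  have hG0 : F = G 0 := by simp [hGdef]
  have hGc : ∀ r ≤ ℓ + 1, Continuous (G r) := fun r hr =>
    hF.continuous_iteratedDeriv r (by exact_mod_cast hr)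
  have hGd : ∀ r ≤ ℓ, ∀ x, HasDerivAt (G r) (G (r + 1) x) x := fun r hr x => by
    have := (hF.differentiable_iteratedDeriv r (by exact_mod_cast Nat.lt_succ_of_le hr) x).hasDerivAt
    rwa [← iteratedDeriv_succ] at this
  set Z : Ω → ℝ := fun ω => a * Y ω + b * W ω with hZ
  have hZm : Measurable Z := by fun_prop
  have hWi := integrable_abs_pow_of_gaussian hW hv
  have hZi : ∀ k ≤ ℓ + 2, Integrable (fun ω => |Z ω| ^ k) μ := fun k hk =>
    integrable_abs_linear_comb_pow hY hW (hYi k hk) (hWi k) a b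
  have hκ1 : κ 1 = 0 := by
    simpa [hY0] using (isCumulantSeq_iff.1 hκ 0 (by omega)).symm
  have hκ2 : κ 2 = v := by
    have := isCumulantSeq_iff.1 hκ 1 (by omega)
    simp [Finset.sum_range_succ, hκ1] at this
    rw [hvar, this]
  set κZ : ℕ → ℝ := fun k => a ^ k * κ k + if k = 2 then b ^ 2 * v else 0 with hκZ
  have hκZc : IsCumulantSeq μ Z (ℓ + 2) κZ := hκ.add_gaussian hY hYi hW hind hv a b
  have hκZ1 : κZ 1 = 0 := by simp [hκZ, hκ1]
  have hκZ2 : κZ 2 = v := by simp [hκZ, hκ2, hb2]; ring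
  have hZ2 : ∫ ω, Z ω ^ 2 ∂μ = v := by
    have := isCumulantSeq_iff.1 hκZc 1 (by omega)
    simpa [Finset.sum_range_succ, hκZ1, hκZ2] using this
  obtain ⟨B, hB⟩ := hFb (ℓ + 1) le_rfl
  have hB0 : 0 ≤ B := (norm_nonneg _).trans (hB 0)
  set s := ⨆ x ∈ Set.Icc (-Q) Q, ‖G (ℓ + 1) x‖
  set S := ⨆ x, ‖G (ℓ + 1) x‖
  have hs0 : 0 ≤ s := Real.iSup_nonneg fun x => Real.iSup_nonneg fun _ => norm_nonneg _
  have hS0 : 0 ≤ S := Real.iSup_nonneg fun x => norm_nonneg _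
  have hS : ∀ x, ‖G (ℓ + 1) x‖ ≤ S := fun x => le_ciSup (f := fun x => ‖G (ℓ + 1) x‖)
    ⟨B, by rintro _ ⟨y, rfl⟩; exact hB y⟩ x
  have hs : ∀ x, |x| ≤ Q → ‖G (ℓ + 1) x‖ ≤ s := fun x hx => by
    have hx' : x ∈ Set.Icc (-Q) Q := abs_le.1 hx
    refine le_ciSup_of_le (f := fun x => ⨆ _ : x ∈ Set.Icc (-Q) Q, ‖G (ℓ + 1) x‖)
      ⟨B, ?_⟩ x ?_
    · rintro _ ⟨y, rfl⟩
      exact Real.iSup_le (fun _ => hB y) hB0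
    · simp [hx'.1, hx'.2]
  set h : ℝ → ℝ := fun x => s + if Q < x then S else 0 with hh
  have hhm : Measurable h :=
    measurable_const.add (Measurable.ite measurableSet_Ioi measurable_const measurable_const)
  have hmono : Monotone h := fun x y hxy => by
    simp only [hh]
    gcongr
    split_ifs <;> linarith
  have hh0 : ∀ x, 0 ≤ h x := fun x => by simp only [hh]; split_ifs <;> linarith
  have hhS : ∀ x, h x ≤ s + S := fun x => by simp only [hh]; split_ifs <;> linarith
  have hGh : ∀ x, ‖G (ℓ + 1) x‖ ≤ h |x| := fun x => by
    simp only [hh]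
    split_ifs with hq
    · linarith [hS x]
    · linarith [hs x (not_lt.1 hq)]
  have hexp := norm_integral_smul_sub_cumulant_sum_le hZm hZi hκZc hκZ1 hGd
    (fun r hr => hFb r (by omega)) hhm (hmono.monotoneOn _) hh0 ⟨_, hhS⟩ hGh
  set A := ∫ ω, |Z ω| ^ (ℓ + 2) * h |Z ω| ∂μ with hA
  have hA0 : 0 ≤ A := integral_nonneg fun ω => mul_nonneg (by positivity) (hh0 _)
  have hAeq : A = (∫ ω, |Z ω| ^ (ℓ + 2) ∂μ) * s
      + (∫ ω in {ω | Q < |Z ω|}, |Z ω| ^ (ℓ + 2) ∂μ) * S :=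
    integral_mul_add_ite (hZi _ le_rfl) (by fun_prop) Q s S
  have hGi : ∀ r ≤ ℓ + 1, Integrable (fun ω => G r (Z ω)) μ := fun r hr => by
    obtain ⟨C, hC⟩ := hFb r hr
    exact (integrable_const C).mono'
      ((hGc r hr).stronglyMeasurable.comp_measurable hZm).aestronglyMeasurable
      (ae_of_all _ fun ω => hC _)
  have hmulG : ∀ {U : Ω → ℝ}, Measurable U → Integrable (fun ω => |U ω| ^ 1) μ →
      Integrable (fun ω => U ω • G 0 (Z ω)) μ := fun {U} hU hUi => by
    obtain ⟨C, hC⟩ := hFb 0 (by omega)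
    refine (hUi.mul_const C).mono' (hU.aestronglyMeasurable.smul
      (hGi 0 (by omega)).aestronglyMeasurable) (ae_of_all _ fun ω => ?_)
    rw [norm_smul, pow_one, Real.norm_eq_abs]
    gcongr
    exact hC _
  have hstein : ∫ ω, W ω • G 0 (Z ω) ∂μ = (b * v) • ∫ ω, G 1 (Z ω) ∂μ :=
    integral_gaussian_smul_comp_add hY hW hind hv (hGd 0 (by omega)) (hGc 1 (by omega)) a b
      (hGi 0 (by omega)) (hmulG hW (hWi 1)) (hGi 1 (by omega))
  have hflow : ∫ ω, (-(1/2) * a * Y ω + a ^ 2 / (2 * b) * W ω) • G 0 (Z ω) ∂μ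
      = (-(1/2) : ℝ) • ∫ ω, Z ω • G 0 (Z ω) ∂μ + ((1/2 : ℝ) * v) • ∫ ω, G 1 (Z ω) ∂μ := by
    have e : ∀ ω, (-(1/2) * a * Y ω + a ^ 2 / (2 * b) * W ω) • G 0 (Z ω)
        = (-(1/2) : ℝ) • (Z ω • G 0 (Z ω)) + (1 / (2 * b)) • (W ω • G 0 (Z ω)) := fun ω => by
      rw [smul_smul, smul_smul, ← add_smul]
      congr 1
      rw [show a ^ 2 = 1 - b ^ 2 by linarith]
      simp only [hZ]
      field_simp
      ring
    simp_rw [e]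
    have i1 : Integrable (fun ω => (-(1/2) : ℝ) • (Z ω • G 0 (Z ω))) μ :=
      (hmulG hZm (hZi 1 (by omega))).smul (-(1/2) : ℝ)
    have i2 : Integrable (fun ω => (1 / (2 * b)) • (W ω • G 0 (Z ω))) μ :=
      (hmulG hW (hWi 1)).smul (1 / (2 * b))
    rw [integral_add i1 i2, integral_smul, integral_smul, hstein, smul_smul]
    congr 2
    field_simp
  have hsumeq : ∑ r ∈ Finset.Icc 2 ℓ, (κ (r + 1) / (Nat.factorial r : ℝ)
        * Real.exp (-((r : ℝ) + 1) * t / 2)) • ∫ ω, G r (Z ω) ∂μ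
      = ∑ r ∈ Finset.Icc 2 ℓ, (κZ (r + 1) / (Nat.factorial r : ℝ)) • ∫ ω, G r (Z ω) ∂μ := by
    refine Finset.sum_congr rfl fun r hr => ?_
    have hr := (Finset.mem_Icc.1 hr).1
    have hea : Real.exp (-((r : ℝ) + 1) * t / 2) = a ^ (r + 1) := by
      rw [ha, ← Real.exp_nat_mul]; congr 1; push_cast; ring
    rw [hea]
    simp only [hκZ, if_neg (show r + 1 ≠ 2 by omega), add_zero]
    congr 1
    ring
  have hgoal : ‖∫ ω, (-(1/2) * a * Y ω + a ^ 2 / (2 * b) * W ω) • G 0 (Z ω) ∂μ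
      + (1/2 : ℂ) * ∑ r ∈ Finset.Icc 2 ℓ, (κ (r + 1) / (Nat.factorial r : ℝ)
        * Real.exp (-((r : ℝ) + 1) * t / 2)) • ∫ ω, G r (Z ω) ∂μ‖ ≤ 2 ^ ℓ * A := by
    rw [hflow, hsumeq]
    rcases Nat.eq_zero_or_pos ℓ with rfl | hl
    · simp only [zero_add, Finset.sum_range_one, hκZ1, zero_div, zero_smul, sub_zero] at hexp
      have hI : ‖∫ ω, G 1 (Z ω) ∂μ‖ ≤ ∫ ω, |Z ω| ^ 0 * h |Z ω| ∂μ := by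
        refine norm_integral_le_of_norm_le ?_ (ae_of_all _ fun ω => ?_)
        · refine (integrable_const (s + S)).mono' (by fun_prop) (ae_of_all _ fun ω => ?_)
          simpa [abs_of_nonneg (hh0 _)] using hhS |Z ω|
        · simpa using hGh (Z ω)
      have hi : ∀ k ≤ 2, Integrable (fun ω => |Z ω| ^ k * h |Z ω|) μ := fun k hk =>
        ((hZi k hk).mul_const (s + S)).mono' (by fun_prop) (ae_of_all _ fun ω => by
          rw [Real.norm_of_nonneg (mul_nonneg (by positivity) (hh0 _))]
          gcongr
          exact hhS _)
      have hassoc := integral_abs_pow_mul_le (hmono.monotoneOn _) hh0 (hZi 2 le_rfl)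
        (hi 0 (by omega)) (hi 2 le_rfl)
      simp_rw [sq_abs] at hassoc
      rw [hZ2] at hassoc
      have hvI : (v : ℝ) * ‖∫ ω, G 1 (Z ω) ∂μ‖ ≤ A := by
        refine (mul_le_mul_of_nonneg_left hI v.2).trans (hassoc.trans (le_of_eq ?_))
        simp [hA]
      simp only [Finset.Icc_eq_empty_of_lt (show 0 < 2 by omega), Finset.sum_empty, mul_zero,
        add_zero]
      refine (norm_add_le _ _).trans ?_
      rw [norm_smul, norm_smul, norm_mul, Real.norm_of_nonneg (NNReal.coe_nonneg v),
        show ‖(-(1/2) : ℝ)‖ = 1/2 by norm_num, show ‖(1/2 : ℝ)‖ = 1/2 by norm_num]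
      linarith
    · have hsplit : ∑ r ∈ Finset.range (ℓ + 1),
          (κZ (r + 1) / (Nat.factorial r : ℝ)) • ∫ ω, G r (Z ω) ∂μ
          = (v : ℝ) • ∫ ω, G 1 (Z ω) ∂μ + ∑ r ∈ Finset.Icc 2 ℓ,
            (κZ (r + 1) / (Nat.factorial r : ℝ)) • ∫ ω, G r (Z ω) ∂μ := by
        rw [Finset.range_eq_Ico, Finset.sum_eq_sum_Ico_succ_bot (by omega),
          Finset.sum_eq_sum_Ico_succ_bot (by omega), ← Finset.Ico_add_one_right_eq_Icc]
        simp [hκZ1, hκZ2]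
      rw [hsplit] at hexp
      have e : ∀ x y z : ℂ, (-(1/2) : ℝ) • x + ((1/2 : ℝ) * v) • y + (1/2 : ℂ) * z
          = (-(1/2) : ℝ) • (x - ((v : ℝ) • y + z)) := fun x y z => by
        simp only [Complex.real_smul]
        push_cast
        ring
      rw [e, norm_smul]
      have h2 : (2 : ℝ) ^ (ℓ + 1) = 2 * 2 ^ ℓ := by ring
      rw [h2] at hexp
      rw [show ‖(-(1/2) : ℝ)‖ = 1/2 by norm_num]
      linarith
  calc _ = _ := by rw [hG0]; simp only [Complex.real_smul]; rfl
    _ ≤ 2 ^ ℓ * A := hgoal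
    _ = _ := by rw [hAeq]; ring
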